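/- arXiv:1605.06374 — 3 statements merged into one kernel-verified Lean document; each statement's English description precedes it below -/
import Mathlib

section
/- Let (X,f) be a dynamical system and g ∈ D_m(I). If the g-fuzzification f̃_g is transitive on (F^1(X), d_∞), then the induced set-valued map f̄ is weakly mixing on (K(X), d_H), i.e., f̄ × f̄ is transitive on K(X) × K(X). -/
noncomputable section

open Set Metric

/-- The unit interval `I = [0,1]` as a subset of `ℝ`. -/
def I01 : Set ℝ := Set.Icc 0 1

/-- `g ∈ D_m(I)`: `g : I → I` is nondecreasing, right-continuous, `g 0 = 0`, `g 1 = 1`. -/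
def Dm (g : ℝ → ℝ) : Prop :=
  MonotoneOn g I01 ∧
  (∀ x ∈ I01, ContinuousWithinAt g (I01 ∩ Set.Ici x) x) ∧
  Set.MapsTo g I01 I01 ∧ g 0 = 0 ∧ g 1 = 1

/-- `ξ_g x = min g⁻¹([x,1])` (the min exists by right-continuity; `sInf` here). -/
def xiG (g : ℝ → ℝ) (x : ℝ) : ℝ := sInf {t | t ∈ I01 ∧ x ≤ g t}

/-- The `α`-cut `[A]_α` of a fuzzy set `A`. -/
def cut {X : Type*} (A : X → ℝ) (α : ℝ) : Set X := {x | α ≤ A x}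

/-- The support of a fuzzy set. -/
def supp {X : Type*} [TopologicalSpace X] (A : X → ℝ) : Set X := closure {x | 0 < A x}

/-- The `g`-cut `[A]_α^g = {x ∈ supp A : g (A x) ≥ α}`. -/
def gcut {X : Type*} [TopologicalSpace X] (g : ℝ → ℝ) (A : X → ℝ) (α : ℝ) : Set X :=
  {x | x ∈ supp A ∧ α ≤ g (A x)}

/-- `A ∈ F(X)`: an upper semicontinuous fuzzy set on `X`. -/
def IsFuzzy {X : Type*} [TopologicalSpace X] (A : X → ℝ) : Prop :=
  UpperSemicontinuous A ∧ ∀ x, A x ∈ I01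

/-- `A ∈ F_0(X)`: a nonempty (not identically 0) upper semicontinuous fuzzy set. -/
def InF0 {X : Type*} [TopologicalSpace X] (A : X → ℝ) : Prop := IsFuzzy A ∧ ∃ x, A x ≠ 0

/-- `A ∈ F^1(X)`: an upper semicontinuous fuzzy set attaining the value 1. -/
def InF1 {X : Type*} [TopologicalSpace X] (A : X → ℝ) : Prop := IsFuzzy A ∧ ∃ x, 1 ≤ A x

/-- The `g`-fuzzification `f̃_g(A)(x) = sup {g (A y) : y ∈ f⁻¹(x)}` (with `sup ∅ = 0`). -/
def fuzz {X : Type*} (f : X → X) (g : ℝ → ℝ) (A : X → ℝ) : X → ℝ :=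
  fun x => sSup ((fun y => g (A y)) '' (f ⁻¹' {x}))

open Classical in
/-- Hausdorff metric, extended by `d_H(∅,∅) = 0` and `d_H(∅,A) = diam X`. -/
def dH {X : Type*} [MetricSpace X] (A B : Set X) : ℝ :=
  if A = ∅ ∧ B = ∅ then 0
  else if A = ∅ ∨ B = ∅ then Metric.diam (Set.univ : Set X)
  else Metric.hausdorffDist A B

/-- The levelwise metric `d_∞(A,B) = sup {d_H([A]_α, [B]_α) : α ∈ (0,1]}`. -/
def dInfty {X : Type*} [MetricSpace X] (A B : X → ℝ) : ℝ :=
  sSup ((fun α => dH (cut A α) (cut B α)) '' Set.Ioc (0:ℝ) 1)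

/-- `K(X)`: the hyperspace of nonempty compact subsets of `X`. -/
def Kc (X : Type*) [MetricSpace X] : Set (Set X) := {A | IsCompact A ∧ A.Nonempty}

section Dyn

variable {Y : Type*}

/-- `U` is a (relatively) open subset of the space `(S, ρ)`. -/
def IsOpenIn (S : Set Y) (ρ : Y → Y → ℝ) (U : Set Y) : Prop :=
  U ⊆ S ∧ ∀ x ∈ U, ∃ ε > 0, ∀ y ∈ S, ρ x y < ε → y ∈ U

/-- Diameter of a set with respect to the distance function `ρ`. -/
def diamIn (ρ : Y → Y → ℝ) (U : Set Y) : ℝ := sSup (Set.image2 ρ U U)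

/-- Sensitive dependence on initial conditions of `T` on the space `(S, ρ)`. -/
def SensitiveOn (S : Set Y) (ρ : Y → Y → ℝ) (T : Y → Y) : Prop :=
  ∃ δ > 0, ∀ x ∈ S, ∀ ε > 0, ∃ y ∈ S, ρ x y < ε ∧ ∃ n : ℕ, δ < ρ (T^[n] x) (T^[n] y)

/-- `𝓕`-sensitivity of `T` on the space `(S, ρ)`. -/
def FSensitiveOn (S : Set Y) (ρ : Y → Y → ℝ) (T : Y → Y) (F : Set (Set ℕ)) : Prop :=
  ∃ ε > 0, ∀ U : Set Y, IsOpenIn S ρ U → U.Nonempty →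
    {n : ℕ | ε < diamIn ρ (T^[n] '' U)} ∈ F

/-- Multi-sensitivity of `T` on the space `(S, ρ)`. -/
def MultiSensitiveOn (S : Set Y) (ρ : Y → Y → ℝ) (T : Y → Y) : Prop :=
  ∃ ε > 0, ∀ (k : ℕ) (U : Fin k → Set Y),
    (∀ i, IsOpenIn S ρ (U i) ∧ (U i).Nonempty) →
    ∃ n : ℕ, ∀ i, ε < diamIn ρ (T^[n] '' U i)

/-- Topological transitivity of `T` on the space `(S, ρ)`. -/
def TransitiveOn (S : Set Y) (ρ : Y → Y → ℝ) (T : Y → Y) : Prop :=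
  ∀ U V : Set Y, IsOpenIn S ρ U → U.Nonempty → IsOpenIn S ρ V → V.Nonempty →
    ∃ n : ℕ, ((T^[n] '' U) ∩ V).Nonempty

/-- Weak mixing: `T × T` is transitive on `(S × S, max-metric)`. -/
def WeaklyMixingOn (S : Set Y) (ρ : Y → Y → ℝ) (T : Y → Y) : Prop :=
  TransitiveOn (S ×ˢ S) (fun p q => max (ρ p.1 q.1) (ρ p.2 q.2)) (Prod.map T T)

end Dyn

/-- A (proper) Furstenberg family on `ℤ⁺ = ℕ`. -/
def FurstenbergFamily (F : Set (Set ℕ)) : Prop :=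
  (∀ F1 F2 : Set ℕ, F1 ∈ F → F1 ⊆ F2 → F2 ∈ F) ∧ Set.univ ∈ F ∧ ∅ ∉ F

theorem dist_lt_of_dInfty_lt {X : Type*} [MetricSpace X] [CompactSpace X] {A B : X → ℝ}
    (hA : ∃ x, 1 ≤ A x) (hB : ∃ x, 1 ≤ B x) {ε : ℝ} (hAB : dInfty A B < ε)
    {α : ℝ} (hα : α ∈ Set.Ioc (0 : ℝ) 1) :
    (∀ x, α ≤ A x → ∃ y, α ≤ B y ∧ dist x y < ε) ∧
      ∀ y, α ≤ B y → ∃ x, α ≤ A x ∧ dist x y < ε := by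
  have hne : ∀ {C : X → ℝ} {β : ℝ}, (∃ x, 1 ≤ C x) → β ≤ 1 → (cut C β).Nonempty :=
    fun ⟨x, hx⟩ hβ => ⟨x, hβ.trans hx⟩
  have hdH : ∀ β ∈ Set.Ioc (0 : ℝ) 1,
      dH (cut A β) (cut B β) = hausdorffDist (cut A β) (cut B β) := by
    intro β hβ
    simp [dH, (hne hA hβ.2).ne_empty, (hne hB hβ.2).ne_empty]
  have hbdd : BddAbove ((fun β => dH (cut A β) (cut B β)) '' Set.Ioc (0 : ℝ) 1) := by
    refine ⟨diam (univ : Set X), ?_⟩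
    rintro _ ⟨β, hβ, rfl⟩
    have hb : Bornology.IsBounded (univ : Set X) := isCompact_univ.isBounded
    obtain ⟨a, ha⟩ := hne hA hβ.2
    obtain ⟨b, hb'⟩ := hne hB hβ.2
    simp only [hdH β hβ]
    exact hausdorffDist_le_of_mem_dist diam_nonneg
      (fun x _ => ⟨b, hb', dist_le_diam_of_mem hb (mem_univ _) (mem_univ _)⟩)
      (fun x _ => ⟨a, ha, dist_le_diam_of_mem hb (mem_univ _) (mem_univ _)⟩)
  have hlt : hausdorffDist (cut A α) (cut B α) < ε := by
    rw [← hdH α hα]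
    exact (le_csSup hbdd (mem_image_of_mem _ hα)).trans_lt hAB
  have hfin : hausdorffEDist (cut A α) (cut B α) ≠ ⊤ :=
    hausdorffEDist_ne_top_of_nonempty_of_bounded (hne hA hα.2) (hne hB hα.2)
      (isCompact_univ.isBounded.subset (subset_univ _))
      (isCompact_univ.isBounded.subset (subset_univ _))
  exact ⟨fun x hx => exists_dist_lt_of_hausdorffDist_lt hx hlt hfin,
    fun y hy => exists_dist_lt_of_hausdorffDist_lt' hy hlt hfin⟩

theorem exists_ne_zero_of_fuzz_iterate_ne_zero {X : Type*} {f : X → X} {g : ℝ → ℝ}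
    (hg : g 0 = 0) (n : ℕ) {A : X → ℝ} {y : X} (hy : (fuzz f g)^[n] A y ≠ 0) :
    ∃ x, f^[n] x = y ∧ A x ≠ 0 := by
  induction n generalizing y with
  | zero => exact ⟨y, rfl, hy⟩
  | succ n ih =>
    rw [Function.iterate_succ_apply'] at hy
    obtain ⟨z, hz, hgz⟩ : ∃ z, f z = y ∧ g ((fuzz f g)^[n] A z) ≠ 0 := by
      by_contra! hcon
      refine hy (le_antisymm (Real.sSup_nonpos ?_) (Real.sSup_nonneg ?_)) <;>
      · rintro _ ⟨z, hz, rfl⟩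
        exact (hcon z hz).symm ▸ le_rfl
    obtain ⟨x, hx, hAx⟩ := ih (y := z) fun h0 => hgz (by rw [h0, hg])
    exact ⟨x, by rw [Function.iterate_succ_apply', hx, hz], hAx⟩

/-- Transitivity of the fuzzification makes the return time sets `N(U, V i)` of a single open set
`U` to finitely many open sets `V i` meet. -/
theorem exists_common_hitting_time {X : Type*} [MetricSpace X] [CompactSpace X]
    {f : X → X} {g : ℝ → ℝ} (hg : g 0 = 0)
    (h : TransitiveOn {A : X → ℝ | InF1 A} dInfty (fuzz f g))
    {ι : Type*} [Finite ι] {U : Set X} (hU : IsOpen U) (hUne : U.Nonempty)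
    {V : ι → Set X} (hV : ∀ i, IsOpen (V i)) (hVne : ∀ i, (V i).Nonempty) :
    ∃ n : ℕ, ∀ i, ∃ x ∈ U, f^[n] x ∈ V i := by
  obtain ⟨u, hu⟩ := hUne
  have hmeet := h
    {C | InF1 C ∧ ∃ δ > 0, ∀ x, 0 < C x → ball x δ ⊆ U}
    {C | InF1 C ∧ ∀ i, ∃ x ∈ V i, 1 ≤ C x} ?_ ?_ ?_ ?_
  · obtain ⟨n, _, ⟨C, ⟨hC, δ, hδ, hCU⟩, rfl⟩, -, hCV⟩ := hmeet
    refine ⟨n, fun i => ?_⟩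
    obtain ⟨y, hy, hy1⟩ := hCV i
    obtain ⟨x, rfl, hx⟩ := exists_ne_zero_of_fuzz_iterate_ne_zero hg n
      (ne_of_gt (zero_lt_one.trans_le hy1))
    exact ⟨x, hCU x ((hC.1.2 x).1.lt_of_ne' hx) (mem_ball_self hδ), hy⟩
  · refine ⟨fun C hC => hC.1, ?_⟩
    rintro C ⟨hC, δ, hδ, hCU⟩
    refine ⟨δ / 2, half_pos hδ, fun D hD hCD => ⟨hD, δ / 2, half_pos hδ, fun y hy => ?_⟩⟩
    obtain ⟨x, hx, hxy⟩ :=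
      (dist_lt_of_dInfty_lt hC.2 hD.2 hCD ⟨hy, (hD.1.2 y).2⟩).2 y le_rfl
    refine (ball_subset_ball' ?_).trans (hCU x (hy.trans_le hx))
    rw [dist_comm]
    linarith
  · obtain ⟨δ, hδ, hball⟩ := Metric.isOpen_iff.1 hU u hu
    refine ⟨Set.indicator {u} fun _ => 1, ⟨⟨?_, fun x => ?_⟩, u, by simp⟩, δ, hδ, fun x hx => ?_⟩
    · exact isClosed_singleton.upperSemicontinuous_indicator zero_le_one
    · by_cases hx : x = u <;> simp [hx, I01]
    · by_cases hxu : x = u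
      · rwa [hxu]
      · simp [hxu] at hx
  · refine ⟨fun C hC => hC.1, ?_⟩
    rintro C ⟨hC, hCV⟩
    choose x hxV hx1 using hCV
    choose δ hδ hball using fun i => Metric.isOpen_iff.1 (hV i) (x i) (hxV i)
    obtain ⟨ε, hε, hεδ⟩ : ∃ ε > 0, ∀ i, ε ≤ δ i := by
      cases nonempty_fintype ι
      by_cases hι : Nonempty ι
      · obtain ⟨i, hi⟩ := Finite.exists_min δ
        exact ⟨δ i, hδ i, hi⟩
      · exact ⟨1, one_pos, fun i => (hι ⟨i⟩).elim⟩
    refine ⟨ε, hε, fun D hD hCD => ⟨hD, fun i => ?_⟩⟩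
    obtain ⟨y, hy, hxy⟩ :=
      (dist_lt_of_dInfty_lt hC.2 hD.2 hCD ⟨one_pos, le_rfl⟩).1 (x i) (hx1 i)
    exact ⟨y, hball i (mem_ball'.2 (hxy.trans_le (hεδ i))), hy⟩
  · refine ⟨fun _ => 1, ⟨⟨upperSemicontinuous_const, fun _ => ?_⟩, u, le_rfl⟩, fun i => ?_⟩
    · simp [I01]
    · exact (hVne i).imp fun x hx => ⟨hx, le_rfl⟩

/-- A continuous self-map of a compact space with the transitivity property is onto. -/
theorem surjective_of_hitting {X : Type*} [MetricSpace X] [CompactSpace X]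
    {f : X → X} (hf : Continuous f)
    (h : ∀ U V : Set X, IsOpen U → U.Nonempty → IsOpen V → V.Nonempty →
      ∃ n : ℕ, ∃ x ∈ U, f^[n] x ∈ V) :
    Function.Surjective f := by
  by_contra hsurj
  obtain ⟨v, hv⟩ : ∃ v, v ∉ range f := by
    simpa [Function.Surjective] using hsurj
  obtain ⟨U, W, hU, hW, hfv, hvW, hdisj⟩ :=
    t2_separation (x := f v) (y := v) fun he => hv ⟨v, he⟩
  obtain ⟨n, x, hx, hxW, hxr⟩ := h U (W ∩ (range f)ᶜ) hU ⟨_, hfv⟩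
    (hW.inter (isCompact_range hf).isClosed.isOpen_compl) ⟨v, hvW, hv⟩
  cases n with
  | zero => exact disjoint_left.1 hdisj hx hxW
  | succ n => exact hxr ⟨f^[n] x, (Function.iterate_succ_apply' f n x).symm⟩

/-- If an open set can be steered simultaneously into any finite family of open sets, then so can
any finite family of open sets: weak mixing of all orders. -/
theorem exists_hitting_time_of_common {X : Type*} [TopologicalSpace X] [Nonempty X]
    {f : X → X} (hf : Continuous f) (hsurj : Function.Surjective f) {ι : Type*} [Finite ι]
    (h : ∀ (U : Set X) (V : ι → Set X), IsOpen U → U.Nonempty → (∀ i, IsOpen (V i)) →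
      (∀ i, (V i).Nonempty) → ∃ n : ℕ, ∀ i, ∃ x ∈ U, f^[n] x ∈ V i)
    {U V : ι → Set X} (hU : ∀ i, IsOpen (U i)) (hUne : ∀ i, (U i).Nonempty)
    (hV : ∀ i, IsOpen (V i)) (hVne : ∀ i, (V i).Nonempty) :
    ∃ n : ℕ, ∀ i, ∃ x ∈ U i, f^[n] x ∈ V i := by
  classical
  cases nonempty_fintype ι
  have key : ∀ s : Finset ι, ∃ W : Set X, IsOpen W ∧ W.Nonempty ∧
      ∀ i ∈ s, ∃ m : ℕ, ∀ x ∈ W, f^[m] x ∈ U i := by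
    intro s
    induction s using Finset.induction_on with
    | empty => exact ⟨univ, isOpen_univ, univ_nonempty, by simp⟩
    | insert i s _ ih =>
      obtain ⟨W, hW, hWne, hWs⟩ := ih
      obtain ⟨m, hm⟩ := h W (fun _ => U i) hW hWne (fun _ => hU i) fun _ => hUne i
      obtain ⟨x, hx, hxm⟩ := hm i
      refine ⟨W ∩ f^[m] ⁻¹' U i, hW.inter ((hU i).preimage (hf.iterate m)), ⟨x, hx, hxm⟩, ?_⟩
      intro j hj
      rcases Finset.mem_insert.1 hj with rfl | hj
      · exact ⟨m, fun y hy => hy.2⟩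
      · exact (hWs j hj).imp fun k hk y hy => hk y hy.1
  obtain ⟨W, hW, hWne, hWU⟩ := key Finset.univ
  choose m hm using fun i => hWU i (Finset.mem_univ i)
  obtain ⟨n, hn⟩ := h W (fun i => f^[m i] ⁻¹' V i) hW hWne
    (fun i => (hV i).preimage (hf.iterate _)) fun i => (hVne i).preimage (hsurj.iterate _)
  refine ⟨n, fun i => ?_⟩
  obtain ⟨x, hx, hxV⟩ := hn i
  refine ⟨f^[m i] x, hm i x hx, ?_⟩
  rwa [← Function.iterate_add_apply, Nat.add_comm, Function.iterate_add_apply]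

theorem dH_lt_of_net {X : Type*} [MetricSpace X] {K t : Set X} {r ε : ℝ} (hr : 0 < r)
    (hrε : 2 * r < ε) (htK : t ⊆ K) (ht : t.Nonempty) (hcov : K ⊆ ⋃ x ∈ t, ball x r)
    {ι : Type*} {z c : ι → X} (hc : range c = t) (hz : ∀ i, z i ∈ ball (c i) r) :
    dH K (range z) < ε := by
  have hι : (range z).Nonempty := by
    obtain ⟨_, i, _⟩ := hc.symm ▸ ht
    exact ⟨z i, mem_range_self i⟩
  rw [dH, if_neg fun h => hι.ne_empty h.2,
    if_neg (not_or_intro (ht.mono htK).ne_empty hι.ne_empty)]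
  refine (hausdorffDist_le_of_mem_dist (r := 2 * r) (by positivity) ?_ ?_).trans_lt hrε
  · intro x hx
    obtain ⟨p, hp, hxp⟩ := mem_iUnion₂.1 (hcov hx)
    obtain ⟨i, rfl⟩ := hc.symm ▸ hp
    refine ⟨z i, mem_range_self i, (dist_triangle_right _ _ (c i)).trans ?_⟩
    linarith [mem_ball.1 hxp, mem_ball.1 (hz i)]
  · rintro _ ⟨i, rfl⟩
    exact ⟨c i, htK (hc ▸ mem_range_self i), by linarith [mem_ball.1 (hz i)]⟩

/-- If `f̃_g` is transitive on `(F^1(X), d_∞)`, then `f̄` is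
weakly mixing on `(K(X), d_H)`. -/
theorem stmt14 {X : Type*} [MetricSpace X] [CompactSpace X]
    (f : X → X) (hf : Continuous f) (g : ℝ → ℝ) (hg : Dm g)
    (h : TransitiveOn {A : X → ℝ | InF1 A} dInfty (fuzz f g)) :
    WeaklyMixingOn (Kc X) dH (Set.image f) := by
  rintro 𝒰 𝒱 h𝒰 ⟨⟨K₁, K₂⟩, hK⟩ h𝒱 ⟨⟨L₁, L₂⟩, hL⟩
  obtain ⟨⟨hK₁, hK₁ne⟩, hK₂, hK₂ne⟩ := h𝒰.1 hK
  obtain ⟨⟨hL₁, hL₁ne⟩, hL₂, hL₂ne⟩ := h𝒱.1 hL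
  obtain ⟨ε, hε, hε𝒰⟩ := h𝒰.2 _ hK
  obtain ⟨δ, hδ, hδ𝒱⟩ := h𝒱.2 _ hL
  obtain ⟨r, hr, hrε, hrδ⟩ : ∃ r > 0, 2 * r < ε ∧ 2 * r < δ := by
    refine ⟨min ε δ / 4, by positivity, ?_, ?_⟩ <;>
      linarith [min_le_left ε δ, min_le_right ε δ, lt_min hε hδ]
  have net : ∀ K : Set X, IsCompact K → K.Nonempty →
      ∃ t ⊆ K, t.Nonempty ∧ t.Finite ∧ K ⊆ ⋃ x ∈ t, ball x r := by
    intro K hK hKne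
    obtain ⟨t, htK, htf, hcov⟩ := hK.finite_cover_balls hr
    refine ⟨t, htK, ?_, htf, hcov⟩
    obtain ⟨x, hx⟩ := hKne
    obtain ⟨p, hp, -⟩ := mem_iUnion₂.1 (hcov hx)
    exact ⟨p, hp⟩
  obtain ⟨s₁, hs₁, hs₁ne, hs₁f, hs₁c⟩ := net K₁ hK₁ hK₁ne
  obtain ⟨s₂, hs₂, hs₂ne, hs₂f, hs₂c⟩ := net K₂ hK₂ hK₂ne
  obtain ⟨t₁, ht₁, ht₁ne, ht₁f, ht₁c⟩ := net L₁ hL₁ hL₁ne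
  obtain ⟨t₂, ht₂, ht₂ne, ht₂f, ht₂c⟩ := net L₂ hL₂ hL₂ne
  have := hs₁f.to_subtype
  have := hs₂f.to_subtype
  have := ht₁f.to_subtype
  have := ht₂f.to_subtype
  have := hs₁ne.to_subtype
  have := hs₂ne.to_subtype
  have := ht₁ne.to_subtype
  have := ht₂ne.to_subtype
  have : Nonempty X := ⟨hK₁ne.some⟩
  have hg0 : g 0 = 0 := hg.2.2.2.1
  have hsurj : Function.Surjective f := surjective_of_hitting hf fun U V hU hUne hV hVne => by
    obtain ⟨n, hn⟩ := exists_common_hitting_time hg0 h (ι := Unit) hU hUne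
      (fun _ => hV) fun _ => hVne
    exact ⟨n, hn ()⟩
  let a : (s₁ × t₁) ⊕ (s₂ × t₂) → X := Sum.elim (fun p => p.1) fun p => p.1
  let b : (s₁ × t₁) ⊕ (s₂ × t₂) → X := Sum.elim (fun p => p.2) fun p => p.2
  obtain ⟨n, hn⟩ := exists_hitting_time_of_common hf hsurj
    (fun U V hU hUne hV hVne => exists_common_hitting_time hg0 h hU hUne hV hVne)
    (U := fun i => ball (a i) r) (V := fun i => ball (b i) r)
    (fun _ => isOpen_ball) (fun _ => nonempty_ball.2 hr)
    (fun _ => isOpen_ball) (fun _ => nonempty_ball.2 hr)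
  choose z hza hzb using hn
  have hfst : ∀ s t : Set X, t.Nonempty → range (fun p : s × t => (p.1 : X)) = s := by
    rintro s t ⟨y, hy⟩
    ext x
    exact ⟨fun ⟨p, hp⟩ => hp ▸ p.1.2, fun hx => ⟨(⟨x, hx⟩, ⟨y, hy⟩), rfl⟩⟩
  have hsnd : ∀ s t : Set X, s.Nonempty → range (fun p : s × t => (p.2 : X)) = t := by
    rintro s t ⟨y, hy⟩
    ext x
    exact ⟨fun ⟨p, hp⟩ => hp ▸ p.2.2, fun hx => ⟨(⟨y, hy⟩, ⟨x, hx⟩), rfl⟩⟩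
  have hKc : ∀ {ι : Type _} [Finite ι] [Nonempty ι] (w : ι → X), range w ∈ Kc X :=
    fun w => ⟨(finite_range w).isCompact, range_nonempty w⟩
  refine ⟨n, (range fun p => f^[n] (z (Sum.inl p)), range fun p => f^[n] (z (Sum.inr p))),
    ⟨(range fun p => z (Sum.inl p), range fun p => z (Sum.inr p)), ?_, ?_⟩, ?_⟩
  · exact hε𝒰 _ ⟨hKc _, hKc _⟩ (max_lt
      (dH_lt_of_net hr hrε hs₁ hs₁ne hs₁c (hfst s₁ t₁ ht₁ne) fun p => hza (Sum.inl p))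
      (dH_lt_of_net hr hrε hs₂ hs₂ne hs₂c (hfst s₂ t₂ ht₂ne) fun p => hza (Sum.inr p)))
  · rw [Prod.map_iterate, ← Set.image_iterate_eq]
    simp only [Prod.map_apply, ← range_comp]
    rfl
  · exact hδ𝒱 _ ⟨hKc _, hKc _⟩ (max_lt
      (dH_lt_of_net hr hrδ ht₁ ht₁ne ht₁c (hsnd s₁ t₁ hs₁ne) fun p => hzb (Sum.inl p))
      (dH_lt_of_net hr hrδ ht₂ ht₂ne ht₂c (hsnd s₂ t₂ hs₂ne) fun p => hzb (Sum.inr p)))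
end
end

section
/- Let (X,f) be a dynamical system and g ∈ D_m(I). If the g-fuzzification f̃_g is transitive on (F^1(X), d_∞), then the induced set-valued map f̄ is transitive on (K(X), d_H). -/
noncomputable section

open Set Metric

theorem Dm.exists_threshold {g : ℝ → ℝ} (hg : Dm g) {a : ℝ} (ha : a ∈ Ioc (0 : ℝ) 1) :
    ∃ ξ ∈ Ioc (0 : ℝ) 1, ∀ t ∈ I01, a ≤ g t ↔ ξ ≤ t := by
  obtain ⟨hmono, hcont, -, h0, h1⟩ := hg
  set S : Set ℝ := {t | t ∈ I01 ∧ a ≤ g t}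
  have hone : (1 : ℝ) ∈ S := ⟨⟨zero_le_one, le_rfl⟩, h1.symm ▸ ha.2⟩
  have hbdd : BddBelow S := ⟨0, fun t ht => ht.1.1⟩
  have hI : sInf S ∈ I01 := ⟨le_csInf ⟨1, hone⟩ fun t ht => ht.1.1, csInf_le hbdd hone⟩
  have hle : a ≤ g (sInf S) := by
    have hcl : g (sInf S) ∈ closure (g '' S) :=
      ((hcont _ hI).mono fun t ht => ⟨ht.1, csInf_le hbdd ht⟩).mem_closure_image
        (csInf_mem_closure ⟨1, hone⟩ hbdd)
    have hsub : g '' S ⊆ Ici a := by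
      rintro _ ⟨t, ht, rfl⟩
      exact ht.2
    exact closure_minimal hsub isClosed_Ici hcl
  have hpos : 0 < sInf S := by
    refine lt_of_le_of_ne hI.1 fun h => ?_
    rw [← h, h0] at hle
    exact hle.not_gt ha.1
  exact ⟨sInf S, ⟨hpos, hI.2⟩, fun t ht =>
    ⟨fun h => csInf_le hbdd ⟨ht, h⟩, fun h => hle.trans (hmono hI ht h)⟩⟩

theorem fuzz_eq_zero {X : Type*} {f : X → X} (g : ℝ → ℝ) (A : X → ℝ) {x : X}
    (hx : ¬ (f ⁻¹' {x}).Nonempty) : fuzz f g A x = 0 := by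
  simp [fuzz, not_nonempty_iff_eq_empty.1 hx]

theorem cut_indicator {X : Type*} (C : Set X) {α : ℝ} (hα : α ∈ Ioc (0 : ℝ) 1) :
    cut (C.indicator fun _ => (1 : ℝ)) α = C := by
  ext x
  by_cases hx : x ∈ C <;> simp [cut, hx, hα.1, hα.2]

section Topological

variable {X : Type*} [TopologicalSpace X]

theorem IsFuzzy.isClosed_cut {A : X → ℝ} (hA : IsFuzzy A) (α : ℝ) : IsClosed (cut A α) :=
  upperSemicontinuous_iff_isClosed_preimage.1 hA.1 α

theorem InF1.cut_nonempty {A : X → ℝ} (hA : InF1 A) {α : ℝ} (hα : α ≤ 1) :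
    (cut A α).Nonempty :=
  hA.2.imp fun _ hx => hα.trans hx

theorem inF1_indicator {C : Set X} (hC : IsClosed C) (hne : C.Nonempty) :
    InF1 (C.indicator fun _ => (1 : ℝ)) := by
  refine ⟨⟨hC.upperSemicontinuous_indicator zero_le_one, fun x => ?_⟩, ?_⟩
  · by_cases hx : x ∈ C <;> simp [hx, I01]
  · obtain ⟨x, hx⟩ := hne
    exact ⟨x, by simp [hx]⟩

variable [CompactSpace X] [T2Space X] {f : X → X} {g : ℝ → ℝ}

theorem exists_fuzz_eq (hf : Continuous f) (hg : Dm g) {A : X → ℝ} (hA : IsFuzzy A) {x : X}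
    (hx : (f ⁻¹' {x}).Nonempty) : ∃ y, f y = x ∧ fuzz f g A x = g (A y) := by
  obtain ⟨y, hy, hmax⟩ := (hA.1.upperSemicontinuousOn _).exists_isMaxOn hx
    (isClosed_singleton.preimage hf).isCompact
  refine ⟨y, hy, IsGreatest.csSup_eq ⟨⟨y, hy, rfl⟩, ?_⟩⟩
  rintro _ ⟨z, hz, rfl⟩
  exact hg.1 (hA.2 z) (hA.2 y) (hmax hz)

theorem fuzz_mem_I01 (hf : Continuous f) (hg : Dm g) {A : X → ℝ} (hA : IsFuzzy A) (x : X) :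
    fuzz f g A x ∈ I01 := by
  by_cases hx : (f ⁻¹' {x}).Nonempty
  · obtain ⟨y, -, hy⟩ := exists_fuzz_eq hf hg hA hx
    exact hy ▸ hg.2.2.1 (hA.2 y)
  · rw [fuzz_eq_zero g A hx]
    exact ⟨le_rfl, zero_le_one⟩

theorem cut_fuzz (hf : Continuous f) (hg : Dm g) {A : X → ℝ} (hA : IsFuzzy A) {a ξ : ℝ}
    (ha : 0 < a) (hξ : ∀ t ∈ I01, a ≤ g t ↔ ξ ≤ t) :
    cut (fuzz f g A) a = f '' cut A ξ := by
  ext x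
  constructor
  · intro h
    by_cases hx : (f ⁻¹' {x}).Nonempty
    · obtain ⟨y, hyx, hy⟩ := exists_fuzz_eq hf hg hA hx
      exact ⟨y, (hξ _ (hA.2 y)).1 (hy ▸ h), hyx⟩
    · have h' : a ≤ fuzz f g A x := h
      rw [fuzz_eq_zero g A hx] at h'
      exact absurd ha h'.not_gt
  · rintro ⟨y, hy, rfl⟩
    refine ((hξ _ (hA.2 y)).2 hy).trans (le_csSup ⟨1, ?_⟩ ⟨y, rfl, rfl⟩)
    rintro _ ⟨z, -, rfl⟩
    exact (hg.2.2.1 (hA.2 z)).2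

theorem IsFuzzy.fuzz (hf : Continuous f) (hg : Dm g) {A : X → ℝ} (hA : IsFuzzy A) :
    IsFuzzy (fuzz f g A) := by
  refine ⟨upperSemicontinuous_iff_isClosed_preimage.2 fun a => ?_, fuzz_mem_I01 hf hg hA⟩
  by_cases h0 : 0 < a
  · by_cases h1 : a ≤ 1
    · obtain ⟨ξ, -, hξ⟩ := hg.exists_threshold ⟨h0, h1⟩
      have hcut := cut_fuzz hf hg hA h0 hξ
      change IsClosed (cut _ a)
      rw [hcut]
      exact ((hA.isClosed_cut ξ).isCompact.image hf).isClosed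
    · convert isClosed_empty (X := X)
      exact eq_empty_of_forall_notMem fun x hx =>
        h1 (le_trans hx (fuzz_mem_I01 hf hg hA x).2)
  · convert isClosed_univ (X := X)
    exact eq_univ_of_forall fun x => (not_lt.1 h0).trans (fuzz_mem_I01 hf hg hA x).1

theorem exists_cut_iterate_fuzz (hf : Continuous f) (hg : Dm g) (n : ℕ) {A : X → ℝ}
    (hA : IsFuzzy A) {a : ℝ} (ha : a ∈ Ioc (0 : ℝ) 1) :
    ∃ ξ ∈ Ioc (0 : ℝ) 1, cut ((fuzz f g)^[n] A) a = (image f)^[n] (cut A ξ) := by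
  induction n generalizing A with
  | zero => exact ⟨a, ha, rfl⟩
  | succ n ih =>
    obtain ⟨β, hβ, hcut⟩ := ih (hA.fuzz hf hg)
    obtain ⟨ξ, hξ, hξg⟩ := hg.exists_threshold hβ
    refine ⟨ξ, hξ, ?_⟩
    rw [Function.iterate_succ_apply, Function.iterate_succ_apply, hcut,
      cut_fuzz hf hg hA hβ.1 hξg]

end Topological

section Metrical

variable {X : Type*} [MetricSpace X]

theorem dH_of_nonempty {A B : Set X} (hA : A.Nonempty) (hB : B.Nonempty) :
    dH A B = hausdorffDist A B := by
  simp [dH, hA.ne_empty, hB.ne_empty]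

theorem dH_triangle {A B C : Set X} (hA : A ∈ Kc X) (hB : B ∈ Kc X) (hC : C ∈ Kc X) :
    dH A C ≤ dH A B + dH B C := by
  rw [dH_of_nonempty hA.2 hC.2, dH_of_nonempty hA.2 hB.2, dH_of_nonempty hB.2 hC.2]
  exact hausdorffDist_triangle
    (hausdorffEDist_ne_top_of_nonempty_of_bounded hA.2 hB.2 hA.1.isBounded hB.1.isBounded)

/-- The fuzzy sets of `F^1(X)` whose cuts all lie in `U`, uniformly away from its complement. -/
def uniformCutsIn (U : Set (Set X)) : Set (X → ℝ) :=
  {A | InF1 A ∧ ∃ δ > 0, ∀ α ∈ Ioc (0 : ℝ) 1, ∀ B ∈ Kc X, dH (cut A α) B < δ → B ∈ U}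

theorem uniformCutsIn_nonempty {U : Set (Set X)} (hU : IsOpenIn (Kc X) dH U)
    (hne : U.Nonempty) : (uniformCutsIn U).Nonempty := by
  obtain ⟨C, hC⟩ := hne
  obtain ⟨ε, hε, h⟩ := hU.2 C hC
  refine ⟨_, inF1_indicator (hU.1 hC).1.isClosed (hU.1 hC).2, ε, hε, fun α hα B hB hlt => ?_⟩
  rw [cut_indicator C hα] at hlt
  exact h B hB hlt

variable [CompactSpace X]

theorem InF1.cut_mem_Kc {A : X → ℝ} (hA : InF1 A) {α : ℝ} (hα : α ≤ 1) : cut A α ∈ Kc X :=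
  ⟨(hA.1.isClosed_cut α).isCompact, hA.cut_nonempty hα⟩

theorem dH_cut_le_dInfty {A B : X → ℝ} (hA : InF1 A) (hB : InF1 B) {α : ℝ}
    (hα : α ∈ Ioc (0 : ℝ) 1) : dH (cut A α) (cut B α) ≤ dInfty A B := by
  refine le_csSup ⟨diam (univ : Set X), ?_⟩ ⟨α, hα, rfl⟩
  rintro _ ⟨β, hβ, rfl⟩
  have hb : Bornology.IsBounded (univ : Set X) := isCompact_univ.isBounded
  dsimp only
  rw [dH_of_nonempty (hA.cut_nonempty hβ.2) (hB.cut_nonempty hβ.2)]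
  exact (hausdorffDist_le_diam (hA.cut_nonempty hβ.2) (hb.subset (subset_univ _))
    (hB.cut_nonempty hβ.2) (hb.subset (subset_univ _))).trans
    (diam_mono (subset_univ _) hb)

theorem cut_mem_of_mem_uniformCutsIn {U : Set (Set X)} {A : X → ℝ} (hA : A ∈ uniformCutsIn U)
    {α : ℝ} (hα : α ∈ Ioc (0 : ℝ) 1) : cut A α ∈ U := by
  obtain ⟨hF, δ, hδ, h⟩ := hA
  refine h α hα _ (hF.cut_mem_Kc hα.2) ?_
  rwa [dH_of_nonempty (hF.cut_nonempty hα.2) (hF.cut_nonempty hα.2), hausdorffDist_self_zero]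

theorem isOpenIn_uniformCutsIn (U : Set (Set X)) :
    IsOpenIn {A : X → ℝ | InF1 A} dInfty (uniformCutsIn U) := by
  refine ⟨fun A hA => hA.1, ?_⟩
  rintro A ⟨hA, δ, hδ, h⟩
  refine ⟨δ / 2, half_pos hδ, fun A' hA' hAA' => ⟨hA', δ / 2, half_pos hδ, ?_⟩⟩
  intro α hα B hB hlt
  refine h α hα B hB ?_
  have := dH_triangle (hA.cut_mem_Kc hα.2) (InF1.cut_mem_Kc hA' hα.2) hB
  have := dH_cut_le_dInfty hA hA' hα
  linarith

end Metrical

/-- If `f̃_g` is transitive on `(F^1(X), d_∞)`, then `f̄` is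
transitive on `(K(X), d_H)`. -/
theorem stmt15 {X : Type*} [MetricSpace X] [CompactSpace X]
    (f : X → X) (hf : Continuous f) (g : ℝ → ℝ) (hg : Dm g)
    (h : TransitiveOn {A : X → ℝ | InF1 A} dInfty (fuzz f g)) :
    TransitiveOn (Kc X) dH (Set.image f) := by
  intro U V hU hUne hV hVne
  obtain ⟨n, _, ⟨A, hA, rfl⟩, hAV⟩ :=
    h _ _ (isOpenIn_uniformCutsIn U) (uniformCutsIn_nonempty hU hUne)
      (isOpenIn_uniformCutsIn V) (uniformCutsIn_nonempty hV hVne)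
  have h1 : (1 : ℝ) ∈ Ioc (0 : ℝ) 1 := ⟨one_pos, le_rfl⟩
  obtain ⟨ξ, hξ, hcut⟩ := exists_cut_iterate_fuzz hf hg n hA.1.1 h1
  exact ⟨n, _, ⟨_, cut_mem_of_mem_uniformCutsIn hA hξ, rfl⟩,
    hcut ▸ cut_mem_of_mem_uniformCutsIn hAV h1⟩
end
end

section
/- Define g : [0,1] → [0,1] by g(0) = 0, g(x) = 1 − 2^{−n} for x ∈ [1 − 2^{−n}, 1 − 2^{−(n+1)}) with n ∈ ℤ⁺, and g(1) = 1. Then g ∈ D_m(I); moreover ξ_g(0) = 0, ξ_g(x) = 1 − 2^{−(n+1)} for x ∈ (1 − 2^{−n}, 1 − 2^{−(n+1)}] with n ∈ ℤ⁺, and ξ_g(1) = 1. In particular, for z = 1/4 one has ξ_g(z) = 1/2 ≠ z and ξ_g^{n}(z) = 1/2 for all n ≥ 1, so ξ_g^2(z) = ξ_g(z). -/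
noncomputable section

open Set Metric

theorem exists_dyadic_step {x : ℝ} (hx0 : 0 ≤ x) (hx1 : x < 1) :
    ∃ n : ℕ, 1 - (1/2:ℝ)^n ≤ x ∧ x < 1 - (1/2:ℝ)^(n+1) := by
  obtain ⟨n, h, h'⟩ := exists_nat_pow_near_of_lt_one (x := 1 - x) (y := (1/2:ℝ))
    (by linarith) (by linarith) (by norm_num) (by norm_num)
  exact ⟨n, by linarith, by linarith⟩

section DyadicStep

variable {g : ℝ → ℝ}

theorem dyadicStep_le_self (h1 : g 1 = 1)
    (hstep : ∀ n : ℕ, ∀ x : ℝ,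
      1 - (1/2:ℝ)^n ≤ x → x < 1 - (1/2:ℝ)^(n+1) → g x = 1 - (1/2:ℝ)^n)
    {x : ℝ} (hx : x ∈ I01) : g x ≤ x := by
  rcases hx.2.lt_or_eq with hlt | rfl
  · obtain ⟨n, hn, hn'⟩ := exists_dyadic_step hx.1 hlt
    exact (hstep n x hn hn').trans_le hn
  · exact h1.le

theorem le_dyadicStep (h1 : g 1 = 1)
    (hstep : ∀ n : ℕ, ∀ x : ℝ,
      1 - (1/2:ℝ)^n ≤ x → x < 1 - (1/2:ℝ)^(n+1) → g x = 1 - (1/2:ℝ)^n)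
    {x : ℝ} (hx : x ∈ I01) {n : ℕ} (hn : 1 - (1/2:ℝ)^n ≤ x) : 1 - (1/2:ℝ)^n ≤ g x := by
  rcases hx.2.lt_or_eq with hlt | rfl
  · obtain ⟨m, hm, hm'⟩ := exists_dyadic_step hx.1 hlt
    rw [hstep m x hm hm']
    have hnm : n < m + 1 := by
      by_contra! h
      have := pow_le_pow_of_le_one (by norm_num : (0:ℝ) ≤ 1/2) (by norm_num) h
      linarith
    have := pow_le_pow_of_le_one (by norm_num : (0:ℝ) ≤ 1/2) (by norm_num)
      (Nat.le_of_lt_succ hnm)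
    linarith
  · rw [h1]
    have : (0:ℝ) < (1/2)^n := by positivity
    linarith

theorem dyadicStep_mem_Dm (h0 : g 0 = 0) (h1 : g 1 = 1)
    (hstep : ∀ n : ℕ, ∀ x : ℝ,
      1 - (1/2:ℝ)^n ≤ x → x < 1 - (1/2:ℝ)^(n+1) → g x = 1 - (1/2:ℝ)^n) : Dm g := by
  refine ⟨fun x hx y hy hxy => ?_, fun x hx => ?_, fun x hx => ⟨?_, ?_⟩, h0, h1⟩
  · rcases hx.2.lt_or_eq with hlt | rfl
    · obtain ⟨n, hn, hn'⟩ := exists_dyadic_step hx.1 hlt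
      rw [hstep n x hn hn']
      exact le_dyadicStep h1 hstep hy (hn.trans hxy)
    · rw [le_antisymm hy.2 hxy]
  · rcases hx.2.lt_or_eq with hlt | rfl
    · obtain ⟨n, hn, hn'⟩ := exists_dyadic_step hx.1 hlt
      refine (continuousWithinAt_const (b := 1 - (1/2:ℝ)^n)).congr_of_eventuallyEq ?_
        (hstep n x hn hn')
      filter_upwards [self_mem_nhdsWithin, mem_nhdsWithin_of_mem_nhds (Iio_mem_nhds hn')]
        with y hy hy'
      exact hstep n y (hn.trans hy.2) hy'
    · refine (continuousWithinAt_singleton (f := g) (x := 1)).mono fun y hy => ?_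
      exact le_antisymm hy.1.2 hy.2
  · have := le_dyadicStep h1 hstep hx (n := 0) (by simpa using hx.1)
    simpa using this
  · exact (dyadicStep_le_self h1 hstep hx).trans hx.2

theorem xiG_zero (h0 : g 0 = 0) : xiG g 0 = 0 :=
  IsLeast.csInf_eq ⟨⟨by simp [I01], h0.ge⟩, fun _ ht => ht.1.1⟩

theorem xiG_dyadicStep (h1 : g 1 = 1)
    (hstep : ∀ n : ℕ, ∀ x : ℝ,
      1 - (1/2:ℝ)^n ≤ x → x < 1 - (1/2:ℝ)^(n+1) → g x = 1 - (1/2:ℝ)^n)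
    (n : ℕ) (x : ℝ) (hx : 1 - (1/2:ℝ)^n < x) (hx' : x ≤ 1 - (1/2:ℝ)^(n+1)) :
    xiG g x = 1 - (1/2:ℝ)^(n+1) := by
  have hmem : 1 - (1/2:ℝ)^(n+1) ∈ I01 :=
    ⟨sub_nonneg.2 (pow_le_one₀ (by norm_num) (by norm_num)), sub_le_self _ (by positivity)⟩
  refine IsLeast.csInf_eq ⟨⟨hmem, hx'.trans (le_dyadicStep h1 hstep hmem le_rfl)⟩, ?_⟩
  rintro t ⟨ht, hxt⟩
  by_contra! hlt
  have hle := dyadicStep_le_self h1 hstep ht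
  have := hstep n t (by linarith) hlt
  linarith

theorem xiG_dyadicStep_one (h1 : g 1 = 1)
    (hstep : ∀ n : ℕ, ∀ x : ℝ,
      1 - (1/2:ℝ)^n ≤ x → x < 1 - (1/2:ℝ)^(n+1) → g x = 1 - (1/2:ℝ)^n) :
    xiG g 1 = 1 :=
  IsLeast.csInf_eq ⟨⟨by simp [I01], h1.ge⟩,
    fun _ ht => ht.2.trans (dyadicStep_le_self h1 hstep ht.1)⟩

end DyadicStep

/-- The step function `g` with `g 0 = 0`, `g x = 1 - 2⁻ⁿ` on
`[1 - 2⁻ⁿ, 1 - 2⁻⁽ⁿ⁺¹⁾)` and `g 1 = 1` belongs to `D_m(I)`; moreover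
`ξ_g 0 = 0`, `ξ_g x = 1 - 2⁻⁽ⁿ⁺¹⁾` on `(1 - 2⁻ⁿ, 1 - 2⁻⁽ⁿ⁺¹⁾]`, `ξ_g 1 = 1`;
and for `z = 1/4`: `ξ_g z = 1/2 ≠ z`, `ξ_gⁿ z = 1/2` for all `n ≥ 1`, so
`ξ_g² z = ξ_g z`. -/
theorem stmt18 (g : ℝ → ℝ)
    (h0 : g 0 = 0) (h1 : g 1 = 1)
    (hstep : ∀ n : ℕ, ∀ x : ℝ,
      1 - (1/2:ℝ)^n ≤ x → x < 1 - (1/2:ℝ)^(n+1) → g x = 1 - (1/2:ℝ)^n) :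
    Dm g ∧
    xiG g 0 = 0 ∧
    (∀ n : ℕ, ∀ x : ℝ,
      1 - (1/2:ℝ)^n < x → x ≤ 1 - (1/2:ℝ)^(n+1) → xiG g x = 1 - (1/2:ℝ)^(n+1)) ∧
    xiG g 1 = 1 ∧
    xiG g (1/4) = 1/2 ∧
    xiG g (1/4) ≠ 1/4 ∧
    (∀ n : ℕ, 1 ≤ n → (xiG g)^[n] (1/4) = 1/2) ∧
    (xiG g)^[2] (1/4) = (xiG g)^[1] (1/4) := by
  have hxi := xiG_dyadicStep h1 hstep
  have hquarter : xiG g (1/4) = 1/2 := by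
    rw [hxi 0 (1/4) (by norm_num) (by norm_num)]; norm_num
  have hhalf : xiG g (1/2) = 1/2 := by
    rw [hxi 0 (1/2) (by norm_num) (by norm_num)]; norm_num
  have hiter : ∀ n : ℕ, 1 ≤ n → (xiG g)^[n] (1/4) = 1/2 := by
    intro n hn
    obtain ⟨k, rfl⟩ := Nat.exists_eq_add_of_le' hn
    rw [Function.iterate_succ_apply, hquarter, Function.iterate_fixed hhalf]
  refine ⟨dyadicStep_mem_Dm h0 h1 hstep, xiG_zero h0, hxi, xiG_dyadicStep_one h1 hstep,
    hquarter, ?_, hiter, ?_⟩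
  · rw [hquarter]; norm_num
  · rw [hiter 2 (by norm_num), hiter 1 le_rfl]
end
end
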